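/- arXiv:2604.09147 — 2 statements merged into one kernel-verified Lean document; each statement's English description precedes it below -/
import Mathlib

section
/- Let N, d, L ≥ 1 be integers, 0 ≤ ℓ ≤ L, p ≥ 1, ε > 0, and C′, C″, C‴ ≥ 0. Let H̃, Ĥ ∈ ℝ^{N×N}. Suppose there is a finite family 𝔅 of pairwise disjoint index blocks B = I_B × J_B (I_B, J_B ⊆ {1,…,N}), each assigned a level l(B) ∈ {1,…,L}, such that: (i) H̃ and Ĥ agree at every entry outside the union of the blocks; (ii) for each level l with 1 ≤ l ≤ ℓ, the number of blocks of level l is at most C′·2^{dl}, except that at level ℓ the number of blocks may be up to (C′ + C″)·2^{dℓ}, and for each level l with ℓ+1 ≤ l ≤ L the number of blocks of level l is at most C‴·2^{dl}; (iii) for each block B of level l there is a real u_B > 0 with u_B · ‖H̃_{I_B,J_B}‖_F ≤ ε · 2^{−dl/2} · ‖H̃‖_F and ‖H̃_{I_B,J_B} − Ĥ_{I_B,J_B}‖_F ≤ (2 + √p · u_B) · u_B · ‖H̃_{I_B,J_B}‖_F. Let ū = max_{B ∈ 𝔅} u_B (set ū = 0 if 𝔅 is empty). Then ‖H̃ − Ĥ‖_F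 ≤ (2 + √p · ū) · √(ℓ·C′ + C″ + (L−ℓ)·C‴) · ε · ‖H̃‖_F. -/
/-- Frobenius norm of a real matrix. -/
noncomputable def frobNorm {m n : Type*} [Fintype m] [Fintype n]
    (A : Matrix m n ℝ) : ℝ :=
  Real.sqrt (∑ i, ∑ j, (A i j) ^ 2)

/-- Frobenius norm of the block `A_{I,J}` of a matrix `A`. -/
noncomputable def blockFrobNorm {N : ℕ} (A : Matrix (Fin N) (Fin N) ℝ)
    (I J : Finset (Fin N)) : ℝ :=
  Real.sqrt (∑ i ∈ I, ∑ j ∈ J, (A i j) ^ 2)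

/-- If the entries of `A` vanish outside a family of blocks, its squared Frobenius norm is at most
the sum of the squared block norms. -/
theorem frobNorm_sq_le_sum_blockFrobNorm_sq {N : ℕ} {β : Type*} [Fintype β]
    (A : Matrix (Fin N) (Fin N) ℝ) (I J : β → Finset (Fin N))
    (hA : ∀ i j, (∀ B, (i, j) ∉ I B ×ˢ J B) → A i j = 0) :
    frobNorm A ^ 2 ≤ ∑ B, blockFrobNorm A (I B) (J B) ^ 2 := by
  classical
  have hblock : ∀ B, blockFrobNorm A (I B) (J B) ^ 2
      = ∑ i, ∑ j, if (i, j) ∈ I B ×ˢ J B then A i j ^ 2 else 0 := by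
    intro B
    rw [blockFrobNorm, Real.sq_sqrt (by positivity), ← Finset.sum_product', ← Finset.sum_product',
      ← Finset.sum_filter]
    refine Finset.sum_congr ?_ fun _ _ => rfl
    ext x
    simp
  simp_rw [hblock]
  rw [frobNorm, Real.sq_sqrt (by positivity), Finset.sum_comm (s := (Finset.univ : Finset β))]
  refine Finset.sum_le_sum fun i _ => ?_
  rw [Finset.sum_comm (s := (Finset.univ : Finset β))]
  refine Finset.sum_le_sum fun j _ => ?_
  have hnonneg : ∀ B ∈ (Finset.univ : Finset β),
      0 ≤ if (i, j) ∈ I B ×ˢ J B then A i j ^ 2 else 0 := by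
    intro B _
    split_ifs <;> positivity
  by_cases h : ∀ B, (i, j) ∉ I B ×ˢ J B
  · rw [hA i j h]
    simp
  · push Not at h
    obtain ⟨B, hB⟩ := h
    simpa only [if_pos hB] using Finset.single_le_sum hnonneg (Finset.mem_univ B)

/-- If level `l` contains at most `c l * w l` elements, weighting each element by the inverse of
`w` at its level gives a total of at most `∑ c l`. -/
theorem sum_inv_level_le {β : Type*} [Fintype β] (lev : β → ℕ) (s : Finset ℕ)
    (hlev : ∀ B, lev B ∈ s) (c w : ℕ → ℝ) (hw : ∀ l, 0 < w l)
    (hcount : ∀ l ∈ s, ((Finset.univ.filter fun B => lev B = l).card : ℝ) ≤ c l * w l) :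
    ∑ B, (w (lev B))⁻¹ ≤ ∑ l ∈ s, c l := by
  rw [← Finset.sum_fiberwise_of_maps_to (fun B _ => hlev B)]
  refine Finset.sum_le_sum fun l hl => ?_
  have hfiber : ∑ B with lev B = l, (w (lev B))⁻¹ = ∑ B with lev B = l, (w l)⁻¹ :=
    Finset.sum_congr rfl fun B hB => by rw [(Finset.mem_filter.mp hB).2]
  rw [hfiber, Finset.sum_const, nsmul_eq_mul, ← div_eq_mul_inv, div_le_iff₀ (hw l)]
  exact hcount l hl

theorem sum_hybrid_level_constants_le (L ℓ : ℕ) (hℓ : ℓ ≤ L) (a b c : ℝ) (hb : 0 ≤ b) :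
    ∑ l ∈ Finset.Icc 1 L, ((if l ≤ ℓ then a else c) + if l = ℓ then b else 0)
      ≤ ℓ * a + b + ((L : ℝ) - ℓ) * c := by
  have hle : (Finset.Icc 1 L).filter (· ≤ ℓ) = Finset.Icc 1 ℓ := by
    ext l; simp only [Finset.mem_filter, Finset.mem_Icc]; omega
  have hgt : (Finset.Icc 1 L).filter (fun l => ¬ l ≤ ℓ) = Finset.Icc (ℓ + 1) L := by
    ext l; simp only [Finset.mem_filter, Finset.mem_Icc]; omega
  have hswitch : (∑ l ∈ Finset.Icc 1 L, if l = ℓ then b else 0) ≤ b := by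
    rw [Finset.sum_ite_eq']
    split_ifs <;> linarith
  rw [Finset.sum_add_distrib, Finset.sum_ite, hle, hgt]
  simp only [Finset.sum_const, Nat.card_Icc, nsmul_eq_mul, Nat.add_sub_cancel,
    Nat.add_sub_add_right, Nat.cast_sub hℓ]
  linarith

/-- rigorous form of the key estimate (4.8) in the proof of
Theorem 4.3: the mixed precision representation `Ĥ` of the hybrid hierarchical
matrix `H̃`, with the adaptive precision selection rule
`u_B ‖H̃_B‖_F ≤ ε 2^{−dl/2} ‖H̃‖_F` and per-block storage error
`‖H̃_B − Ĥ_B‖_F ≤ (2 + √p u_B) u_B ‖H̃_B‖_F`, satisfies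
`‖H̃ − Ĥ‖_F ≤ (2 + √p ū) √(ℓC′ + C″ + (L−ℓ)C‴) ε ‖H̃‖_F`. -/
theorem mixed_precision_global_error
    (N d L : ℕ) (hN : 1 ≤ N) (hd : 1 ≤ d) (hL : 1 ≤ L)
    (ℓ : ℕ) (hℓ : ℓ ≤ L)
    (p : ℕ) (hp : 1 ≤ p)
    (ε : ℝ) (hε : 0 < ε)
    (C' C'' C''' : ℝ) (hC' : 0 ≤ C') (hC'' : 0 ≤ C'') (hC''' : 0 ≤ C''')
    (Ht Hh : Matrix (Fin N) (Fin N) ℝ)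
    (𝔅 : Type) [Fintype 𝔅]
    (I J : 𝔅 → Finset (Fin N)) (lev : 𝔅 → ℕ)
    (hlev : ∀ B : 𝔅, 1 ≤ lev B ∧ lev B ≤ L)
    (hdisj : ∀ B B' : 𝔅, B ≠ B' →
      Disjoint ((I B) ×ˢ (J B)) ((I B') ×ˢ (J B')))
    (hagree : ∀ i j : Fin N, (∀ B : 𝔅, (i, j) ∉ (I B) ×ˢ (J B)) → Ht i j = Hh i j)
    (hcount_std : ∀ l : ℕ, 1 ≤ l → l ≤ ℓ → l ≠ ℓ →
      (((Finset.univ.filter (fun B : 𝔅 => lev B = l)).card : ℝ)) ≤ C' * 2 ^ (d * l))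
    (hcount_switch :
      (((Finset.univ.filter (fun B : 𝔅 => lev B = ℓ)).card : ℝ)) ≤ (C' + C'') * 2 ^ (d * ℓ))
    (hcount_weak : ∀ l : ℕ, ℓ + 1 ≤ l → l ≤ L →
      (((Finset.univ.filter (fun B : 𝔅 => lev B = l)).card : ℝ)) ≤ C''' * 2 ^ (d * l))
    (u : 𝔅 → ℝ) (hu : ∀ B : 𝔅, 0 < u B)
    (hprec : ∀ B : 𝔅, u B * blockFrobNorm Ht (I B) (J B) ≤
      ε * (2 : ℝ) ^ (-((d * lev B : ℕ) : ℝ) / 2) * frobNorm Ht)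
    (hblock : ∀ B : 𝔅, blockFrobNorm (Ht - Hh) (I B) (J B) ≤
      (2 + Real.sqrt p * u B) * u B * blockFrobNorm Ht (I B) (J B))
    (ubar : ℝ)
    (hubar : ubar = if h : (Finset.univ : Finset 𝔅).Nonempty
      then Finset.univ.sup' h u else 0) :
    frobNorm (Ht - Hh) ≤ (2 + Real.sqrt p * ubar) *
      Real.sqrt ((ℓ : ℝ) * C' + C'' + ((L : ℝ) - (ℓ : ℝ)) * C''') * ε * frobNorm Ht := by
  have hF : 0 ≤ frobNorm Ht := Real.sqrt_nonneg _
  have hle : ∀ B, u B ≤ ubar := by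
    intro B
    rw [hubar, dif_pos ⟨B, Finset.mem_univ B⟩]
    exact Finset.le_sup' u (Finset.mem_univ B)
  have hubar_nonneg : 0 ≤ ubar := by
    rw [hubar]
    split_ifs with h
    · obtain ⟨B, hB⟩ := h
      exact (hu B).le.trans (Finset.le_sup' u hB)
    · exact le_rfl
  have hK : 0 ≤ (2 + Real.sqrt p * ubar) * ε * frobNorm Ht := by positivity
  set K := (2 + Real.sqrt p * ubar) * ε * frobNorm Ht with hK_def
  have hblock_sq : ∀ B, blockFrobNorm (Ht - Hh) (I B) (J B) ^ 2
      ≤ K ^ 2 * ((2 : ℝ) ^ (d * lev B))⁻¹ := by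
    intro B
    have hpow : ((2 : ℝ) ^ (-((d * lev B : ℕ) : ℝ) / 2)) ^ 2 = ((2 : ℝ) ^ (d * lev B))⁻¹ := by
      rw [← Real.rpow_natCast, ← Real.rpow_mul zero_le_two, Nat.cast_ofNat,
        div_mul_cancel₀ _ two_ne_zero, Real.rpow_neg zero_le_two, Real.rpow_natCast]
    rw [← hpow, ← mul_pow]
    refine pow_le_pow_left₀ (Real.sqrt_nonneg _) ?_ 2
    have hH : 0 ≤ blockFrobNorm Ht (I B) (J B) := Real.sqrt_nonneg _
    have hpos := hu B
    calc blockFrobNorm (Ht - Hh) (I B) (J B)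
        ≤ (2 + Real.sqrt p * u B) * (u B * blockFrobNorm Ht (I B) (J B)) := by
          rw [← mul_assoc]
          exact hblock B
      _ ≤ (2 + Real.sqrt p * ubar) *
            (ε * (2 : ℝ) ^ (-((d * lev B : ℕ) : ℝ) / 2) * frobNorm Ht) := by
          refine mul_le_mul ?_ (hprec B) (by positivity) (by positivity)
          gcongr
          exact hle B
      _ = K * (2 : ℝ) ^ (-((d * lev B : ℕ) : ℝ) / 2) := by
          rw [hK_def]
          ring
  have hweights : ∑ B, ((2 : ℝ) ^ (d * lev B))⁻¹
      ≤ (ℓ : ℝ) * C' + C'' + ((L : ℝ) - (ℓ : ℝ)) * C''' := by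
    refine (sum_inv_level_le lev (Finset.Icc 1 L) (fun B => Finset.mem_Icc.mpr (hlev B))
      (fun l => (if l ≤ ℓ then C' else C''') + if l = ℓ then C'' else 0)
      (fun l => (2 : ℝ) ^ (d * l)) (fun l => by positivity) ?_).trans
      (sum_hybrid_level_constants_le L ℓ hℓ C' C'' C''' hC'')
    intro l hl
    obtain ⟨h1, h2⟩ := Finset.mem_Icc.mp hl
    rcases lt_trichotomy l ℓ with h | h | h
    · simpa [h.le, h.ne] using hcount_std l h1 h.le h.ne
    · subst h
      simpa using hcount_switch
    · simpa [h.not_ge, h.ne'] using hcount_weak l h h2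
  have hsq : frobNorm (Ht - Hh) ^ 2
      ≤ K ^ 2 * ((ℓ : ℝ) * C' + C'' + ((L : ℝ) - (ℓ : ℝ)) * C''') :=
    calc frobNorm (Ht - Hh) ^ 2
        ≤ ∑ B, blockFrobNorm (Ht - Hh) (I B) (J B) ^ 2 :=
          frobNorm_sq_le_sum_blockFrobNorm_sq _ I J fun i j h => by
            rw [Matrix.sub_apply, hagree i j h, sub_self]
      _ ≤ ∑ B, K ^ 2 * ((2 : ℝ) ^ (d * lev B))⁻¹ := Finset.sum_le_sum fun B _ => hblock_sq B
      _ ≤ K ^ 2 * ((ℓ : ℝ) * C' + C'' + ((L : ℝ) - (ℓ : ℝ)) * C''') := by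
          rw [← Finset.mul_sum]
          gcongr
  calc frobNorm (Ht - Hh)
      ≤ Real.sqrt (K ^ 2 * ((ℓ : ℝ) * C' + C'' + ((L : ℝ) - (ℓ : ℝ)) * C''')) :=
        Real.le_sqrt_of_sq_le hsq
    _ = K * Real.sqrt ((ℓ : ℝ) * C' + C'' + ((L : ℝ) - (ℓ : ℝ)) * C''') := by
        rw [Real.sqrt_mul (sq_nonneg K), Real.sqrt_sq hK]
    _ = _ := by
        rw [hK_def]
        ring
end

section
/- Let N, d, L ≥ 1 be integers, 0 ≤ ℓ ≤ L, p ≥ 1, ε > 0, and C′, C″, C‴ ≥ 0. Let H, H̃, Ĥ ∈ ℝ^{N×N}. Suppose there is a finite family 𝔅 of pairwise disjoint index blocks B = I_B × J_B (I_B, J_B ⊆ {1,…,N}), each assigned a level l(B) ∈ {1,…,L}, such that: (i) H, H̃ and Ĥ all agree at every entry outside the union of the blocks; (ii) for every block B, ‖H_{I_B,J_B} − H̃_{I_B,J_B}‖_F ≤ ε ‖H_{I_B,J_B}‖_F; (iii) for each level l with 1 ≤ l ≤ ℓ, the number of blocks of level l is at most C′·2^{dl}, except that at level ℓ the number may be up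 to (C′ + C″)·2^{dℓ}, and for each level l with ℓ+1 ≤ l ≤ L the number of blocks of level l is at most C‴·2^{dl}; (iv) for each block B of level l there is a real u_B > 0 with u_B · ‖H̃_{I_B,J_B}‖_F ≤ ε · 2^{−dl/2} · ‖H̃‖_F and ‖H̃_{I_B,J_B} − Ĥ_{I_B,J_B}‖_F ≤ (2 + √p · u_B) · u_B · ‖H̃_{I_B,J_B}‖_F. Let ū = max_{B ∈ 𝔅} u_B (ū = 0 if 𝔅 is empty). Then ‖H − Ĥ‖_F ≤ ( (2 + √p · ū) · (1 + ε) · √(ℓ·C′ + C″ + (L−ℓ)·C‴) + 1 ) · ε · ‖H‖_F. -/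
lemma frobNorm_nonneg {m n : Type*} [Fintype m] [Fintype n] (A : Matrix m n ℝ) :
    0 ≤ frobNorm A :=
  Real.sqrt_nonneg _

lemma frobNorm_eq_norm_toLp {m n : Type*} [Fintype m] [Fintype n] (A : Matrix m n ℝ) :
    frobNorm A = ‖(WithLp.toLp 2 fun x : m × n => A x.1 x.2 : EuclideanSpace ℝ (m × n))‖ := by
  simp [frobNorm, EuclideanSpace.norm_eq, Fintype.sum_prod_type]

lemma frobNorm_add_le {m n : Type*} [Fintype m] [Fintype n] (A B : Matrix m n ℝ) :
    frobNorm (A + B) ≤ frobNorm A + frobNorm B := by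
  simp only [frobNorm_eq_norm_toLp]
  exact norm_add_le (WithLp.toLp 2 fun x : m × n => A x.1 x.2 : EuclideanSpace ℝ (m × n))
    (WithLp.toLp 2 fun x : m × n => B x.1 x.2)

lemma frobNorm_sub_comm {m n : Type*} [Fintype m] [Fintype n] (A B : Matrix m n ℝ) :
    frobNorm (A - B) = frobNorm (B - A) := by
  simp only [frobNorm, Matrix.sub_apply, sub_sq_comm]

lemma frobNorm_sq {m n : Type*} [Fintype m] [Fintype n] (A : Matrix m n ℝ) :
    frobNorm A ^ 2 = ∑ x : m × n, A x.1 x.2 ^ 2 := by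
  rw [frobNorm, Real.sq_sqrt (by positivity), Fintype.sum_prod_type]

lemma blockFrobNorm_nonneg {N : ℕ} (A : Matrix (Fin N) (Fin N) ℝ) (I J : Finset (Fin N)) :
    0 ≤ blockFrobNorm A I J :=
  Real.sqrt_nonneg _

lemma blockFrobNorm_sq {N : ℕ} (A : Matrix (Fin N) (Fin N) ℝ) (I J : Finset (Fin N)) :
    blockFrobNorm A I J ^ 2 = ∑ x ∈ I ×ˢ J, A x.1 x.2 ^ 2 := by
  rw [blockFrobNorm, Real.sq_sqrt (by positivity), Finset.sum_product]

section Blocks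

variable {N : ℕ} {β : Type*} [Fintype β] {I J : β → Finset (Fin N)}

lemma sum_blockFrobNorm_sq (hdisj : ∀ B B' : β, B ≠ B' → Disjoint (I B ×ˢ J B) (I B' ×ˢ J B'))
    (A : Matrix (Fin N) (Fin N) ℝ) :
    ∑ B, blockFrobNorm A (I B) (J B) ^ 2 =
      ∑ x ∈ Finset.univ.biUnion fun B => I B ×ˢ J B, A x.1 x.2 ^ 2 := by
  rw [Finset.sum_biUnion fun B _ B' _ h => hdisj B B' h]
  simp only [blockFrobNorm_sq]

lemma sum_blockFrobNorm_sq_le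
    (hdisj : ∀ B B' : β, B ≠ B' → Disjoint (I B ×ˢ J B) (I B' ×ˢ J B'))
    (A : Matrix (Fin N) (Fin N) ℝ) :
    ∑ B, blockFrobNorm A (I B) (J B) ^ 2 ≤ frobNorm A ^ 2 := by
  rw [sum_blockFrobNorm_sq hdisj, frobNorm_sq]
  exact Finset.sum_le_sum_of_subset_of_nonneg (Finset.subset_univ _) fun _ _ _ => sq_nonneg _

lemma frobNorm_sq_eq_sum_blockFrobNorm_sq
    (hdisj : ∀ B B' : β, B ≠ B' → Disjoint (I B ×ˢ J B) (I B' ×ˢ J B'))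
    {A : Matrix (Fin N) (Fin N) ℝ}
    (hA : ∀ i j, (∀ B, (i, j) ∉ I B ×ˢ J B) → A i j = 0) :
    frobNorm A ^ 2 = ∑ B, blockFrobNorm A (I B) (J B) ^ 2 := by
  rw [sum_blockFrobNorm_sq hdisj, frobNorm_sq]
  refine (Finset.sum_subset (Finset.subset_univ _) fun x _ hx => ?_).symm
  rw [hA x.1 x.2 fun B hB => hx (Finset.mem_biUnion.2 ⟨B, Finset.mem_univ B, hB⟩), sq, mul_zero]

lemma frobNorm_le_of_blockFrobNorm_le
    (hdisj : ∀ B B' : β, B ≠ B' → Disjoint (I B ×ˢ J B) (I B' ×ˢ J B'))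
    {A M : Matrix (Fin N) (Fin N) ℝ}
    (hA : ∀ i j, (∀ B, (i, j) ∉ I B ×ˢ J B) → A i j = 0) {c : ℝ} (hc : 0 ≤ c)
    (h : ∀ B, blockFrobNorm A (I B) (J B) ≤ c * blockFrobNorm M (I B) (J B)) :
    frobNorm A ≤ c * frobNorm M := by
  refine (sq_le_sq₀ (frobNorm_nonneg _) (mul_nonneg hc (frobNorm_nonneg M))).1 ?_
  calc frobNorm A ^ 2 = ∑ B, blockFrobNorm A (I B) (J B) ^ 2 :=
        frobNorm_sq_eq_sum_blockFrobNorm_sq hdisj hA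
    _ ≤ ∑ B, (c * blockFrobNorm M (I B) (J B)) ^ 2 :=
        Finset.sum_le_sum fun B _ => pow_le_pow_left₀ (blockFrobNorm_nonneg _ _ _) (h B) 2
    _ = c ^ 2 * ∑ B, blockFrobNorm M (I B) (J B) ^ 2 := by simp only [mul_pow, Finset.mul_sum]
    _ ≤ c ^ 2 * frobNorm M ^ 2 :=
        mul_le_mul_of_nonneg_left (sum_blockFrobNorm_sq_le hdisj M) (sq_nonneg c)
    _ = (c * frobNorm M) ^ 2 := (mul_pow _ _ _).symm

end Blocks

/-- Weighting each block of level `l` by `2^{-dl}` turns the level counts into a bound on the total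
weight. -/
lemma sum_inv_two_pow_level_le {β : Type*} [Fintype β] {d ℓ L : ℕ} (hℓ : ℓ ≤ L)
    {C' C'' C''' : ℝ} (hC'' : 0 ≤ C'') {lev : β → ℕ}
    (hlev : ∀ B, 1 ≤ lev B ∧ lev B ≤ L)
    (hcount_std : ∀ l : ℕ, 1 ≤ l → l ≤ ℓ → l ≠ ℓ →
      ((Finset.univ.filter fun B => lev B = l).card : ℝ) ≤ C' * 2 ^ (d * l))
    (hcount_switch :
      ((Finset.univ.filter fun B => lev B = ℓ).card : ℝ) ≤ (C' + C'') * 2 ^ (d * ℓ))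
    (hcount_weak : ∀ l : ℕ, ℓ + 1 ≤ l → l ≤ L →
      ((Finset.univ.filter fun B => lev B = l).card : ℝ) ≤ C''' * 2 ^ (d * l)) :
    ∑ B, ((2 : ℝ) ^ (d * lev B))⁻¹ ≤ ℓ * C' + C'' + ((L : ℝ) - ℓ) * C''' := by
  have hmaps : ∀ B ∈ (Finset.univ : Finset β), lev B ∈ Finset.Icc 1 L :=
    fun B _ => Finset.mem_Icc.2 (hlev B)
  rw [← Finset.sum_fiberwise_of_maps_to hmaps]
  calc _ ≤ ∑ l ∈ Finset.Icc 1 L, ((if l ≤ ℓ then C' else C''') + if l = ℓ then C'' else 0) := by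
        refine Finset.sum_le_sum fun l hl => ?_
        obtain ⟨hl1, hlL⟩ := Finset.mem_Icc.1 hl
        have hsum : ∑ B with lev B = l, ((2 : ℝ) ^ (d * lev B))⁻¹ =
            (Finset.univ.filter fun B => lev B = l).card / 2 ^ (d * l) := by
          rw [Finset.sum_congr rfl fun B hB => by rw [(Finset.mem_filter.1 hB).2],
            Finset.sum_const, nsmul_eq_mul, div_eq_mul_inv]
        rw [hsum, div_le_iff₀ (by positivity)]
        rcases lt_trichotomy l ℓ with h | rfl | h
        · simpa [h.le, h.ne] using hcount_std l hl1 h.le h.ne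
        · simpa using hcount_switch
        · simpa [h.not_ge, h.ne'] using hcount_weak l h hlL
    _ ≤ ℓ * C' + C'' + ((L : ℝ) - ℓ) * C''' := by
        have hle : (Finset.Icc 1 L).filter (fun l => l ≤ ℓ) = Finset.Icc 1 ℓ := by
          ext l; simp only [Finset.mem_filter, Finset.mem_Icc]; omega
        have hgt : (Finset.Icc 1 L).filter (fun l => ¬ l ≤ ℓ) = Finset.Icc (ℓ + 1) L := by
          ext l; simp only [Finset.mem_filter, Finset.mem_Icc]; omega
        have hswitch : (∑ l ∈ Finset.Icc 1 L, if l = ℓ then C'' else 0) ≤ C'' := by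
          rw [Finset.sum_ite_eq']
          split_ifs <;> linarith
        rw [Finset.sum_add_distrib, Finset.sum_ite, hle, hgt]
        simp only [Finset.sum_const, Nat.card_Icc, nsmul_eq_mul, Nat.add_sub_cancel,
          Nat.add_sub_add_right, Nat.cast_sub hℓ]
        linarith

/-- rigorous form of Theorem 4.3, global error in the adaptive
mixed precision `H_h` representation: if `H̃` is a blockwise `ε`-accurate
approximation of `H` (exact outside the disjoint blocks), and `Ĥ` is its mixed
precision representation obeying the adaptive precision rule, then
`‖H − Ĥ‖_F ≤ ((2 + √p ū)(1 + ε)√(ℓC′ + C″ + (L−ℓ)C‴) + 1) ε ‖H‖_F`. -/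
theorem mixed_precision_global_error_vs_H
    (N d L : ℕ) (hN : 1 ≤ N) (hd : 1 ≤ d) (hL : 1 ≤ L)
    (ℓ : ℕ) (hℓ : ℓ ≤ L)
    (p : ℕ) (hp : 1 ≤ p)
    (ε : ℝ) (hε : 0 < ε)
    (C' C'' C''' : ℝ) (hC' : 0 ≤ C') (hC'' : 0 ≤ C'') (hC''' : 0 ≤ C''')
    (H Ht Hh : Matrix (Fin N) (Fin N) ℝ)
    (𝔅 : Type) [Fintype 𝔅]
    (I J : 𝔅 → Finset (Fin N)) (lev : 𝔅 → ℕ)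
    (hlev : ∀ B : 𝔅, 1 ≤ lev B ∧ lev B ≤ L)
    (hdisj : ∀ B B' : 𝔅, B ≠ B' →
      Disjoint ((I B) ×ˢ (J B)) ((I B') ×ˢ (J B')))
    (hagree : ∀ i j : Fin N, (∀ B : 𝔅, (i, j) ∉ (I B) ×ˢ (J B)) →
      H i j = Ht i j ∧ Ht i j = Hh i j)
    (hblockH : ∀ B : 𝔅, blockFrobNorm (H - Ht) (I B) (J B) ≤
      ε * blockFrobNorm H (I B) (J B))
    (hcount_std : ∀ l : ℕ, 1 ≤ l → l ≤ ℓ → l ≠ ℓ →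
      (((Finset.univ.filter (fun B : 𝔅 => lev B = l)).card : ℝ)) ≤ C' * 2 ^ (d * l))
    (hcount_switch :
      (((Finset.univ.filter (fun B : 𝔅 => lev B = ℓ)).card : ℝ)) ≤ (C' + C'') * 2 ^ (d * ℓ))
    (hcount_weak : ∀ l : ℕ, ℓ + 1 ≤ l → l ≤ L →
      (((Finset.univ.filter (fun B : 𝔅 => lev B = l)).card : ℝ)) ≤ C''' * 2 ^ (d * l))
    (u : 𝔅 → ℝ) (hu : ∀ B : 𝔅, 0 < u B)
    (hprec : ∀ B : 𝔅, u B * blockFrobNorm Ht (I B) (J B) ≤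
      ε * (2 : ℝ) ^ (-((d * lev B : ℕ) : ℝ) / 2) * frobNorm Ht)
    (hblock : ∀ B : 𝔅, blockFrobNorm (Ht - Hh) (I B) (J B) ≤
      (2 + Real.sqrt p * u B) * u B * blockFrobNorm Ht (I B) (J B))
    (ubar : ℝ)
    (hubar : ubar = if h : (Finset.univ : Finset 𝔅).Nonempty
      then Finset.univ.sup' h u else 0) :
    frobNorm (H - Hh) ≤
      ((2 + Real.sqrt p * ubar) * (1 + ε) *
        Real.sqrt ((ℓ : ℝ) * C' + C'' + ((L : ℝ) - (ℓ : ℝ)) * C''') + 1) * ε * frobNorm H := by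
  have hCt : 0 ≤ ∑ B, ((2 : ℝ) ^ (d * lev B))⁻¹ := by positivity
  have hlevels := sum_inv_two_pow_level_le hℓ hC'' hlev hcount_std hcount_switch hcount_weak
  set S : ℝ := (ℓ : ℝ) * C' + C'' + ((L : ℝ) - (ℓ : ℝ)) * C'''
  have hu_le : ∀ B, u B ≤ ubar := fun B => by
    rw [hubar, dif_pos ⟨B, Finset.mem_univ B⟩]
    exact Finset.le_sup' u (Finset.mem_univ B)
  have hubar0 : 0 ≤ ubar := by
    rcases isEmpty_or_nonempty 𝔅 with h | ⟨⟨B⟩⟩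
    · simp [hubar]
    · exact (hu B).le.trans (hu_le B)
  set K : ℝ := 2 + Real.sqrt p * ubar
  have hK : 0 ≤ K := by positivity
  have happrox : frobNorm (H - Ht) ≤ ε * frobNorm H :=
    frobNorm_le_of_blockFrobNorm_le hdisj
      (fun i j h => sub_eq_zero.2 (hagree i j h).1) hε.le hblockH
  have hHt : frobNorm Ht ≤ (1 + ε) * frobNorm H := by
    have h := frobNorm_add_le H (Ht - H)
    rw [add_sub_cancel, frobNorm_sub_comm Ht H] at h
    linarith
  have hHt0 := frobNorm_nonneg Ht
  have hstore : frobNorm (Ht - Hh) ≤ K * ε * frobNorm Ht * Real.sqrt S := by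
    refine (sq_le_sq₀ (frobNorm_nonneg _) (by positivity)).1 ?_
    rw [frobNorm_sq_eq_sum_blockFrobNorm_sq (A := Ht - Hh) hdisj
      fun i j h => sub_eq_zero.2 (hagree i j h).2, mul_pow, Real.sq_sqrt (hCt.trans hlevels)]
    refine le_trans ?_ (mul_le_mul_of_nonneg_left hlevels (sq_nonneg _))
    rw [Finset.mul_sum]
    refine Finset.sum_le_sum fun B _ => ?_
    have hB : blockFrobNorm (Ht - Hh) (I B) (J B) ≤
        K * (ε * (2 : ℝ) ^ (-((d * lev B : ℕ) : ℝ) / 2) * frobNorm Ht) := by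
      refine (hblock B).trans ?_
      rw [mul_assoc]
      refine mul_le_mul ?_ (hprec B) (mul_nonneg (hu B).le (blockFrobNorm_nonneg _ _ _)) hK
      have := mul_le_mul_of_nonneg_left (hu_le B) (Real.sqrt_nonneg p)
      simp only [K]
      linarith
    have hpow : ((2 : ℝ) ^ (-((d * lev B : ℕ) : ℝ) / 2)) ^ 2 = ((2 : ℝ) ^ (d * lev B))⁻¹ := by
      rw [← Real.rpow_natCast, ← Real.rpow_mul zero_le_two, ← Real.rpow_natCast 2 (d * lev B),
        ← Real.rpow_neg zero_le_two]
      congr 1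
      push_cast
      ring
    refine (pow_le_pow_left₀ (blockFrobNorm_nonneg _ _ _) hB 2).trans_eq ?_
    rw [← hpow]
    ring
  calc frobNorm (H - Hh) = frobNorm ((H - Ht) + (Ht - Hh)) := by rw [sub_add_sub_cancel]
    _ ≤ ε * frobNorm H + K * ε * frobNorm Ht * Real.sqrt S :=
        (frobNorm_add_le _ _).trans (add_le_add happrox hstore)
    _ ≤ ε * frobNorm H + K * ε * ((1 + ε) * frobNorm H) * Real.sqrt S := by gcongr
    _ = (K * (1 + ε) * Real.sqrt S + 1) * ε * frobNorm H := by ring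
end
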